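/- arXiv:2604.15691 — 2 statements merged into one kernel-verified Lean document; each statement's English description precedes it below -/
import Mathlib

section
/- Let ε = (1,1,…,1) be the all-ones signature, so I^x = ⟨y_i − z_i⟩, I^y = ⟨z_i − x_i⟩, I^z = ⟨x_i − y_i⟩. With respect to the lexicographic monomial order ≺_N, the initial ideals of the pairwise products are: in(I^x · I^y) = ⟨x_i y_j : 1 ≤ i,j ≤ N⟩, in(I^x · I^z) = ⟨x_i y_j : 1 ≤ i,j ≤ N⟩, and in(I^y · I^z) = ⟨x_i x_j : 1 ≤ i,j ≤ N⟩ + ⟨x_k y_ℓ : 1 ≤ k < ℓ ≤ N⟩. -/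
open MvPolynomial

/-- The multidegree (exponent of the leading monomial) of a multivariate
polynomial with respect to a monomial order. -/
noncomputable def mDegree {σ : Type*} (m : MonomialOrder σ)
    (f : MvPolynomial σ ℝ) : σ →₀ ℕ :=
  m.toSyn.symm (f.support.sup m.toSyn)

/-- The initial ideal of an ideal `I` with respect to a monomial order `m`:
the ideal generated by the leading monomials of the nonzero elements of `I`. -/
noncomputable def initialIdeal {σ : Type*} (m : MonomialOrder σ)
    (I : Ideal (MvPolynomial σ ℝ)) : Ideal (MvPolynomial σ ℝ) :=
  Ideal.span {g | ∃ f ∈ I, f ≠ 0 ∧ g = monomial (mDegree m f) (1 : ℝ)}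

/-- The variable `x_i` in `ℝ[x_1,…,x_N,y_1,…,y_N,z_1,…,z_N]`, whose variables
are indexed by `Lex (Fin 3 × Fin N)`; the induced lexicographic monomial order
`MonomialOrder.lex` is exactly `≺_N`, with
`x_1 ≻ ⋯ ≻ x_N ≻ y_1 ≻ ⋯ ≻ y_N ≻ z_1 ≻ ⋯ ≻ z_N`. -/
noncomputable def xv {N : ℕ} (i : Fin N) : MvPolynomial (Lex (Fin 3 × Fin N)) ℝ :=
  X (toLex ((0 : Fin 3), i))

/-- The variable `y_i`. -/
noncomputable def yv {N : ℕ} (i : Fin N) : MvPolynomial (Lex (Fin 3 × Fin N)) ℝ :=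
  X (toLex ((1 : Fin 3), i))

/-- The variable `z_i`. -/
noncomputable def zv {N : ℕ} (i : Fin N) : MvPolynomial (Lex (Fin 3 × Fin N)) ℝ :=
  X (toLex ((2 : Fin 3), i))

lemma X_mul_X_eq_monomial {σ R : Type*} [CommRing R] (i j : σ) :
    (X i * X j : MvPolynomial σ R) = monomial (Finsupp.single i 1 + Finsupp.single j 1) 1 := by
  simp [X, monomial_mul]

lemma monomial_mem_of_le {σ R : Type*} [CommRing R] {J : Ideal (MvPolynomial σ R)} {e d : σ →₀ ℕ}
    (he : monomial e 1 ∈ J) (hed : e ≤ d) : monomial d 1 ∈ J := by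
  rw [← tsub_add_cancel_of_le hed, ← one_mul (1 : R), ← monomial_mul]
  exact J.mul_mem_left _ he

section LexDegree

variable {σ R : Type*} [LinearOrder σ]

/-- If `d` vanishes below `i`, then so does every lexicographically smaller exponent `e`,
and `e i ≤ d i`. -/
lemma lex_le_apply {e d : σ →₀ ℕ} {i : σ} (hle : toLex e ≤ toLex d) (hd : ∀ j < i, d j = 0) :
    (∀ j < i, e j = 0) ∧ e i ≤ d i := by
  rcases hle.eq_or_lt with h | h
  · obtain rfl : e = d := toLex.injective h
    exact ⟨hd, le_rfl⟩
  · obtain ⟨a, ha, hlt⟩ := h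
    change ∀ b < a, e b = d b at ha
    change e a < d a at hlt
    have hia : i ≤ a := by
      by_contra! hai
      rw [hd a hai] at hlt
      exact absurd hlt (Nat.not_lt_zero _)
    refine ⟨fun j hj => (ha j (hj.trans_le hia)).trans (hd j hj), ?_⟩
    rcases hia.eq_or_lt with rfl | hia
    · exact hlt.le
    · exact (ha i hia).le

/-- Replacing variables by smaller ones makes a monomial smaller. -/
lemma lex_mapDomain_le {τ : σ → σ} (hτ : ∀ i, i ≤ τ i) (u : σ →₀ ℕ) :
    toLex (u.mapDomain τ) ≤ toLex u := by
  induction u using Finsupp.induction_linear with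
  | zero => simp
  | add u v hu hv =>
    rw [Finsupp.mapDomain_add, toLex_add, toLex_add]
    exact add_le_add hu hv
  | single i n =>
    rw [Finsupp.mapDomain_single, ← mul_one n, ← smul_eq_mul, ← Finsupp.smul_single,
      ← Finsupp.smul_single, toLex_smul, toLex_smul]
    exact nsmul_le_nsmul_right (Finsupp.Lex.single_le_iff.2 (hτ i)) n

lemma single_add_single_le {i j : σ} (hij : i ≠ j) {d : σ →₀ ℕ} (hi : d i ≠ 0) (hj : d j ≠ 0) :
    Finsupp.single i 1 + Finsupp.single j 1 ≤ d := by
  intro a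
  simp only [Finsupp.add_apply, Finsupp.single_apply]
  split_ifs with h h'
  · exact absurd (h.trans h'.symm) hij
  · subst h; omega
  · subst_vars; omega
  · omega

lemma X_sub_X_ne_zero [CommRing R] [Nontrivial R] {i j : σ} (h : i < j) :
    (X i - X j : MvPolynomial σ R) ≠ 0 :=
  sub_ne_zero.2 fun hij => h.ne (X_injective hij)

variable [WellFoundedGT σ] [CommRing R]

/-- Replacing variables by smaller ones does not kill a polynomial whose leading monomial is
unaffected. -/
lemma rename_ne_zero_of_fixes_degree {τ : σ → σ} (hτ : ∀ i, i ≤ τ i) {f : MvPolynomial σ R}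
    (hf : f ≠ 0) (hfix : ∀ i, MonomialOrder.lex.degree f i ≠ 0 → τ i = i) :
    rename τ f ≠ 0 := by
  set d := MonomialOrder.lex.degree f with hd
  have hmap : d.mapDomain τ = d := by
    conv_rhs => rw [← Finsupp.mapDomain_id (v := d)]
    exact Finsupp.mapDomain_congr fun i hi => hfix i (Finsupp.mem_support_iff.1 hi)
  have hrest : (rename τ (f - monomial d (f.coeff d))).coeff d = 0 := by
    refine coeff_rename_eq_zero _ _ _ fun u hu => ?_
    have hdu : toLex d ≤ toLex u := hu ▸ lex_mapDomain_le hτ u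
    classical
    rw [coeff_sub, coeff_monomial]
    split_ifs with h
    · rw [h, sub_self]
    · rw [sub_zero]
      exact MonomialOrder.lex.coeff_eq_zero_of_lt
        (lt_of_le_of_ne hdu fun h' => h (toLex.injective h'))
  intro h0
  rw [map_sub, rename_monomial, hmap, coeff_sub, h0, coeff_zero, coeff_monomial, if_pos rfl,
    zero_sub, neg_eq_zero] at hrest
  exact MonomialOrder.lex.coeff_degree_ne_zero_iff.2 hf hrest

/-- Subtracting a polynomial in variables smaller than `i` does not change the leading monomial
if that monomial involves `i`. -/
lemma degree_sub_of_supported {f g : MvPolynomial σ R} {i : σ}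
    (hf : MonomialOrder.lex.degree f i ≠ 0) (hg : g ∈ supported R {j | i < j}) :
    MonomialOrder.lex.degree (f - g) = MonomialOrder.lex.degree f := by
  have hvars : ∀ j ≤ i, MonomialOrder.lex.degree (-g) j = 0 := by
    intro j hj
    by_contra h
    have hne : -g ≠ 0 := by
      intro h0
      rw [h0, MonomialOrder.degree_zero] at h
      exact h rfl
    have hjv : j ∈ (-g).vars := (mem_vars_iff_mem_support j).2
      ⟨_, MonomialOrder.lex.degree_mem_support hne, Finsupp.mem_support_iff.2 h⟩
    exact absurd (mem_supported.1 (neg_mem hg) hjv) hj.not_gt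
  rw [sub_eq_add_neg]
  refine MonomialOrder.degree_add_of_lt ?_
  by_contra h
  have := (lex_le_apply (not_lt.1 h) fun j hj => hvars j hj.le).2
  rw [hvars i le_rfl] at this
  exact hf (Nat.le_zero.1 this)

lemma degree_X_sub_X [Nontrivial R] {i j : σ} (h : i < j) :
    MonomialOrder.lex.degree (X i - X j : MvPolynomial σ R) = Finsupp.single i 1 := by
  rw [degree_sub_of_supported (i := i), MonomialOrder.degree_X]
  · simp [MonomialOrder.degree_X]
  · exact X_mem_supported.2 h

/-- The leading monomial of a product of two differences of variables. -/
lemma degree_X_sub_X_mul [IsDomain R] {i j k l : σ} (h : i < j) (h' : k < l) :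
    MonomialOrder.lex.degree ((X i - X j) * (X k - X l) : MvPolynomial σ R) =
      Finsupp.single i 1 + Finsupp.single k 1 := by
  rw [MonomialOrder.degree_mul (X_sub_X_ne_zero h) (X_sub_X_ne_zero h'), degree_X_sub_X h,
    degree_X_sub_X h']

lemma monomial_mem_initialIdeal {I : Ideal (MvPolynomial σ ℝ)} {f : MvPolynomial σ ℝ}
    (hf : f ∈ I) (h0 : f ≠ 0) {d : σ →₀ ℕ} (hd : MonomialOrder.lex.degree f = d) :
    monomial d 1 ∈ initialIdeal MonomialOrder.lex I :=
  Ideal.subset_span ⟨f, hf, h0, by rw [← hd]; rfl⟩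

lemma initialIdeal_le {I J : Ideal (MvPolynomial σ ℝ)}
    (h : ∀ f ∈ I, f ≠ 0 → monomial (MonomialOrder.lex.degree f) 1 ∈ J) :
    initialIdeal MonomialOrder.lex I ≤ J := by
  refine Ideal.span_le.2 ?_
  rintro _ ⟨f, hf, h0, rfl⟩
  exact h f hf h0

end LexDegree

section ThreeBlocks

variable {N : ℕ}

/-- The ideal generated by the differences of corresponding variables in blocks `a` and `b`. -/
noncomputable def blockIdeal (N : ℕ) (a b : Fin 3) :
    Ideal (MvPolynomial (Lex (Fin 3 × Fin N)) ℝ) :=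
  Ideal.span {q | ∃ i : Fin N, q = X (toLex (a, i)) - X (toLex (b, i))}

lemma X_sub_X_mem_blockIdeal (a b : Fin 3) (i : Fin N) :
    X (toLex (a, i)) - X (toLex (b, i)) ∈ blockIdeal N a b :=
  Ideal.subset_span ⟨i, rfl⟩

lemma blockIdeal_le_comm (a b : Fin 3) : blockIdeal N a b ≤ blockIdeal N b a := by
  refine Ideal.span_le.2 ?_
  rintro _ ⟨i, rfl⟩
  rw [← neg_sub]
  exact neg_mem (X_sub_X_mem_blockIdeal b a i)

lemma blockIdeal_comm (a b : Fin 3) : blockIdeal N a b = blockIdeal N b a :=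
  (blockIdeal_le_comm a b).antisymm (blockIdeal_le_comm b a)

lemma rename_eq_zero_of_mem_blockIdeal {a b : Fin 3}
    {τ : Lex (Fin 3 × Fin N) → Lex (Fin 3 × Fin N)}
    (hτ : ∀ i, τ (toLex (a, i)) = τ (toLex (b, i)))
    {f : MvPolynomial (Lex (Fin 3 × Fin N)) ℝ} (hf : f ∈ blockIdeal N a b) :
    rename τ f = 0 := by
  have hle : blockIdeal N a b ≤
      RingHom.ker (rename τ : MvPolynomial _ ℝ →ₐ[ℝ] MvPolynomial _ ℝ) := by
    refine Ideal.span_le.2 ?_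
    rintro _ ⟨i, rfl⟩
    simp [hτ]
  exact hle hf

lemma block_lt {a b : Fin 3} (h : a < b) (i j : Fin N) : toLex (a, i) < toLex (b, j) :=
  Prod.Lex.toLex_lt_toLex.2 (Or.inl h)

lemma index_lt (a : Fin 3) {i j : Fin N} (h : i < j) : toLex (a, i) < toLex (a, j) :=
  Prod.Lex.toLex_lt_toLex.2 (Or.inr ⟨rfl, h⟩)

/-- The leading monomial of a nonzero element of `blockIdeal N a b` involves block `a`. -/
lemma exists_degree_ne_zero_of_mem_blockIdeal {a b : Fin 3} (hab : a < b)
    {f : MvPolynomial (Lex (Fin 3 × Fin N)) ℝ} (hf : f ∈ blockIdeal N a b) (h0 : f ≠ 0) :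
    ∃ i, MonomialOrder.lex.degree f (toLex (a, i)) ≠ 0 := by
  by_contra! h
  let τ : Lex (Fin 3 × Fin N) → Lex (Fin 3 × Fin N) :=
    fun v => if (ofLex v).1 = a then toLex (b, (ofLex v).2) else v
  refine rename_ne_zero_of_fixes_degree (τ := τ) (fun v => ?_) h0 (fun v hv => ?_)
    (rename_eq_zero_of_mem_blockIdeal (τ := τ) (fun i => ?_) hf)
  · obtain ⟨⟨c, i⟩, rfl⟩ := toLex.surjective v
    by_cases hc : c = a
    · subst hc
      simpa [τ] using (block_lt hab i i).le
    · simp [τ, hc]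
  · obtain ⟨⟨c, i⟩, rfl⟩ := toLex.surjective v
    have hc : c ≠ a := by
      rintro rfl
      exact hv (h i)
    simp [τ, hc]
  · simp [τ, hab.ne']

/-- The initial ideal of the product of two block ideals with distinct leading blocks. -/
lemma initialIdeal_mul_blockIdeal {a b c d : Fin 3} (hab : a < b) (hcd : c < d) (hac : a ≠ c) :
    initialIdeal MonomialOrder.lex (blockIdeal N a b * blockIdeal N c d) =
      Ideal.span {q | ∃ i j : Fin N, q = X (toLex (c, i)) * X (toLex (a, j))} := by
  apply le_antisymm
  · refine initialIdeal_le fun f hf h0 => ?_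
    obtain ⟨j, hj⟩ := exists_degree_ne_zero_of_mem_blockIdeal hab (Ideal.mul_le_left hf) h0
    obtain ⟨i, hi⟩ := exists_degree_ne_zero_of_mem_blockIdeal hcd (Ideal.mul_le_right hf) h0
    refine monomial_mem_of_le (e := Finsupp.single (toLex (c, i)) 1 +
      Finsupp.single (toLex (a, j)) 1) ?_ (single_add_single_le ?_ hi hj)
    · rw [← X_mul_X_eq_monomial]
      exact Ideal.subset_span ⟨i, j, rfl⟩
    · simp [hac.symm]
  · refine Ideal.span_le.2 ?_
    rintro _ ⟨i, j, rfl⟩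
    rw [mul_comm (X _), X_mul_X_eq_monomial]
    exact monomial_mem_initialIdeal
      (Ideal.mul_mem_mul (X_sub_X_mem_blockIdeal a b j) (X_sub_X_mem_blockIdeal c d i))
      (mul_ne_zero (X_sub_X_ne_zero (block_lt hab j j)) (X_sub_X_ne_zero (block_lt hcd i i)))
      (degree_X_sub_X_mul (block_lt hab j j) (block_lt hcd i i))

/-- If the leading monomial of a nonzero element of `blockIdeal N 0 2 * blockIdeal N 0 1` is linear
in block `0`, with variable `x_k`, then it involves some `y_l` with `k < l`. -/
lemma exists_lt_degree_ne_zero {f : MvPolynomial (Lex (Fin 3 × Fin N)) ℝ}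
    (hf : f ∈ blockIdeal N 0 2 * blockIdeal N 0 1) (h0 : f ≠ 0) {k : Fin N}
    (hk : MonomialOrder.lex.degree f (toLex (0, k)) = 1)
    (hx : ∀ i ≠ k, MonomialOrder.lex.degree f (toLex (0, i)) = 0) :
    ∃ l, k < l ∧ MonomialOrder.lex.degree f (toLex (1, l)) ≠ 0 := by
  by_contra! hy
  set D := MonomialOrder.lex.degree f with hD
  let xk : Lex (Fin 3 × Fin N) := toLex (0, k)
  let τ : Bool → Lex (Fin 3 × Fin N) → Lex (Fin 3 × Fin N) := fun s v =>
    if (ofLex v).1 = 0 then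
      if s ∧ (ofLex v).2 ≤ k then toLex (1, (ofLex v).2) else toLex (2, (ofLex v).2)
    else if (ofLex v).1 = 1 ∧ k < (ofLex v).2 then toLex (2, (ofLex v).2) else v
  have hf₁ : rename (τ false) f = 0 :=
    rename_eq_zero_of_mem_blockIdeal (fun i => by simp [τ]) (Ideal.mul_le_left hf)
  have hf₂ : rename (τ true) f = 0 := by
    refine rename_eq_zero_of_mem_blockIdeal (fun i => ?_) (Ideal.mul_le_right hf)
    rcases le_or_gt i k with h | h
    · simp [τ, h, h.not_gt]
    · simp [τ, h, h.not_ge]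
  have hagree : ∀ g : MvPolynomial (Lex (Fin 3 × Fin N)) ℝ,
      (∀ m ∈ g.support, ∀ v ≤ xk, m v = 0) → rename (τ true) g = rename (τ false) g := by
    intro g hg
    refine hom_congr_vars (f₁ := (rename (τ true)).toRingHom)
      (f₂ := (rename (τ false)).toRingHom) (by ext; simp) (fun v hv _ => ?_) rfl
    obtain ⟨m, hm, hmv⟩ := (mem_vars_iff_mem_support v).1 hv
    have hvk : ¬ v ≤ xk := fun h => Finsupp.mem_support_iff.1 hmv (hg m hm v h)
    obtain ⟨⟨c, i⟩, rfl⟩ := toLex.surjective v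
    have : c = 0 → ¬ i ≤ k := by
      rintro rfl h
      exact hvk (Prod.Lex.toLex_le_toLex.2 (Or.inr ⟨rfl, h⟩))
    by_cases hc : c = 0
    · simp [τ, hc, this hc]
    · simp [τ, hc]
  set p := f.divMonomial (Finsupp.single xk 1) with hp
  set r := f.modMonomial (Finsupp.single xk 1) with hr
  have hpr : X xk * p + r = f := divMonomial_add_modMonomial_single f xk
  have hDlt : ∀ v < xk, D v = 0 := by
    intro v hv
    obtain ⟨⟨c, i⟩, rfl⟩ := toLex.surjective v
    rcases Prod.Lex.toLex_lt_toLex.1 hv with h | ⟨h, h'⟩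
    · exact absurd h (Fin.not_lt_zero _)
    · obtain rfl : c = 0 := h
      exact hx i h'.ne
  obtain ⟨e, he⟩ : ∃ e, D = Finsupp.single xk 1 + e :=
    exists_add_of_le (Finsupp.single_le_iff.2 hk.ge)
  have hex : ∀ v ≤ xk, e v = 0 := by
    intro v hv
    rcases hv.eq_or_lt with rfl | hv
    · have : D xk = 1 + e xk := by simp [he]
      have : D xk = 1 := hk
      omega
    · have := hDlt v hv
      rw [he] at this
      simpa [hv.ne'] using this
  have hple : ∀ m ∈ p.support, toLex m ≤ toLex e := by
    intro m hm
    have hmf : Finsupp.single xk 1 + m ∈ f.support := by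
      rw [mem_support_iff] at hm ⊢
      rwa [hp, coeff_divMonomial] at hm
    have : toLex (Finsupp.single xk 1 + m) ≤ toLex (Finsupp.single xk 1 + e) := by
      rw [← he]
      exact MonomialOrder.lex.le_degree hmf
    simpa [toLex_add] using this
  have hrlow : ∀ m ∈ r.support, ∀ v ≤ xk, m v = 0 := by
    intro m hm v hv
    have hnle : ¬ Finsupp.single xk 1 ≤ m := fun h =>
      mem_support_iff.1 hm (coeff_modMonomial_of_le f h)
    have hmf : m ∈ f.support := by
      rw [mem_support_iff] at hm ⊢
      rwa [hr, coeff_modMonomial_of_not_le f hnle] at hm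
    rcases hv.eq_or_lt with rfl | hv
    · rw [Finsupp.single_le_iff] at hnle
      omega
    · exact (lex_le_apply (MonomialOrder.lex.le_degree hmf) hDlt).1 v hv
  have hplow : ∀ m ∈ p.support, ∀ v ≤ xk, m v = 0 := by
    intro m hm v hv
    have h := lex_le_apply (hple m hm) fun j hj => hex j hj.le
    rcases hv.eq_or_lt with rfl | hv
    · exact Nat.le_zero.1 (h.2.trans (hex _ le_rfl).le)
    · exact h.1 v hv
  have hcoeff : p.coeff e ≠ 0 := by
    rw [hp, coeff_divMonomial, ← he]
    exact MonomialOrder.lex.coeff_degree_ne_zero_iff.2 h0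
  have hp0 : p ≠ 0 := by
    rintro h
    rw [h, coeff_zero] at hcoeff
    exact hcoeff rfl
  have hdeg : MonomialOrder.lex.degree p = e :=
    toLex.injective (le_antisymm (hple _ (MonomialOrder.lex.degree_mem_support hp0))
      (MonomialOrder.lex.le_degree (mem_support_iff.2 hcoeff)))
  have hzero : rename (τ false) p = 0 := by
    rw [← hpr, map_add, map_mul, rename_X] at hf₁ hf₂
    rw [hagree p hplow, hagree r hrlow] at hf₂
    have hτ₁ : τ false xk = toLex (2, k) := by simp [τ, xk]
    have hτ₂ : τ true xk = toLex (1, k) := by simp [τ, xk]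
    rw [hτ₁] at hf₁
    rw [hτ₂] at hf₂
    have hmul : (X (toLex (1, k)) - X (toLex (2, k))) * rename (τ false) p = 0 := by
      linear_combination hf₂ - hf₁
    exact (mul_eq_zero.1 hmul).resolve_left (X_sub_X_ne_zero (block_lt (by decide) k k))
  refine rename_ne_zero_of_fixes_degree (fun v => ?_) hp0 (fun v hv => ?_) hzero
  · obtain ⟨⟨c, i⟩, rfl⟩ := toLex.surjective v
    by_cases hc : c = 0
    · subst hc
      simpa [τ] using (block_lt (show (0 : Fin 3) < 2 by decide) i i).le
    · by_cases hc' : c = 1 ∧ k < i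
      · obtain ⟨rfl, hi⟩ := hc'
        simpa [τ, hi] using (block_lt (show (1 : Fin 3) < 2 by decide) i i).le
      · simp [τ, hc, hc']
  · rw [hdeg] at hv
    have hDv : D v ≠ 0 := by
      rw [he, Finsupp.add_apply]
      omega
    obtain ⟨⟨c, i⟩, rfl⟩ := toLex.surjective v
    have hc : c ≠ 0 := by
      rintro rfl
      by_cases hik : i = k
      · subst hik
        exact hv (hex _ le_rfl)
      · exact hDv (hx i hik)
    have hc' : ¬ (c = 1 ∧ k < i) := by
      rintro ⟨rfl, hi⟩
      exact hDv (hy i hi)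
    simp [τ, hc, hc']

/-- The monomial `x_k y_l` with `k < l` is the leading monomial of an element of
`blockIdeal N 0 2 * blockIdeal N 0 1`. -/
lemma X_mul_X_mem_initialIdeal {k l : Fin N} (hkl : k < l) :
    X (toLex (0, k)) * X (toLex (1, l)) ∈
      initialIdeal MonomialOrder.lex (blockIdeal N 0 2 * blockIdeal N 0 1) := by
  let x : Fin N → MvPolynomial (Lex (Fin 3 × Fin N)) ℝ := fun i => X (toLex (0, i))
  let y : Fin N → MvPolynomial (Lex (Fin 3 × Fin N)) ℝ := fun i => X (toLex (1, i))
  let z : Fin N → MvPolynomial (Lex (Fin 3 × Fin N)) ℝ := fun i => X (toLex (2, i))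
  have hyz := block_lt (show (1 : Fin 3) < 2 by decide) l l
  have hlead : MonomialOrder.lex.degree (x k * (y l - z l)) =
      Finsupp.single (toLex (0, k)) 1 + Finsupp.single (toLex (1, l)) 1 := by
    rw [MonomialOrder.degree_mul (X_ne_zero _) (X_sub_X_ne_zero hyz), MonomialOrder.degree_X,
      degree_X_sub_X hyz]
  have hsupp : x l * (y k - z k) + (z k * y l - z l * y k) ∈
      supported ℝ {v | toLex ((0 : Fin 3), k) < v} := by
    have hx : x l ∈ supported ℝ {v | toLex ((0 : Fin 3), k) < v} :=
      X_mem_supported.2 (index_lt 0 hkl)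
    have hy (i) : y i ∈ supported ℝ {v | toLex ((0 : Fin 3), k) < v} :=
      X_mem_supported.2 (block_lt (by decide) k i)
    have hz (i) : z i ∈ supported ℝ {v | toLex ((0 : Fin 3), k) < v} :=
      X_mem_supported.2 (block_lt (by decide) k i)
    exact add_mem (mul_mem hx (sub_mem (hy k) (hz k)))
      (sub_mem (mul_mem (hz k) (hy l)) (mul_mem (hz l) (hy k)))
  have hdeg := degree_sub_of_supported (f := x k * (y l - z l)) (by simp [hlead]) hsupp
  rw [X_mul_X_eq_monomial]
  refine monomial_mem_initialIdeal ?_ ?_ (hdeg.trans hlead)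
  · have hmem := sub_mem
      (Ideal.mul_mem_mul (X_sub_X_mem_blockIdeal 0 2 l) (X_sub_X_mem_blockIdeal 0 1 k))
      (Ideal.mul_mem_mul (X_sub_X_mem_blockIdeal 0 2 k) (X_sub_X_mem_blockIdeal 0 1 l))
    convert hmem using 1
    ring
  · refine MonomialOrder.lex.ne_zero_of_degree_ne_zero ?_
    rw [hdeg, hlead]
    simp

end ThreeBlocks

/-- For the all-ones signature, with
`I^x = ⟨y_i - z_i⟩`, `I^y = ⟨z_i - x_i⟩`, `I^z = ⟨x_i - y_i⟩`, the initial
ideals of the pairwise products with respect to the lexicographic monomial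
order `≺_N` are `in(I^x · I^y) = ⟨x_i y_j⟩`, `in(I^x · I^z) = ⟨x_i y_j⟩`, and
`in(I^y · I^z) = ⟨x_i x_j⟩ + ⟨x_k y_ℓ : k < ℓ⟩`. -/
theorem stmt_11 (N : ℕ) (hN : 0 < N)
    (Ix Iy Iz : Ideal (MvPolynomial (Lex (Fin 3 × Fin N)) ℝ))
    (hIx : Ix = Ideal.span {q | ∃ i : Fin N, q = yv i - zv i})
    (hIy : Iy = Ideal.span {q | ∃ i : Fin N, q = zv i - xv i})
    (hIz : Iz = Ideal.span {q | ∃ i : Fin N, q = xv i - yv i}) :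
    initialIdeal MonomialOrder.lex (Ix * Iy) =
        Ideal.span {q | ∃ i j : Fin N, q = xv i * yv j} ∧
    initialIdeal MonomialOrder.lex (Ix * Iz) =
        Ideal.span {q | ∃ i j : Fin N, q = xv i * yv j} ∧
    initialIdeal MonomialOrder.lex (Iy * Iz) =
        Ideal.span {q | ∃ i j : Fin N, q = xv i * xv j} ⊔
          Ideal.span {q | ∃ k l : Fin N, k < l ∧ q = xv k * yv l} := by
  obtain rfl : Ix = blockIdeal N 1 2 := hIx
  obtain rfl : Iy = blockIdeal N 0 2 := hIy.trans (blockIdeal_comm 2 0)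
  obtain rfl : Iz = blockIdeal N 0 1 := hIz
  refine ⟨initialIdeal_mul_blockIdeal (by decide) (by decide) (by decide),
    initialIdeal_mul_blockIdeal (by decide) (by decide) (by decide), le_antisymm ?_ ?_⟩
  · refine initialIdeal_le fun f hf h0 => ?_
    by_contra hmem
    have hxx : ∀ i j : Fin N, ¬ Finsupp.single (toLex (0, i)) 1 + Finsupp.single (toLex (0, j)) 1 ≤
        MonomialOrder.lex.degree f := fun i j hle =>
      hmem (monomial_mem_of_le (Ideal.mem_sup_left (Ideal.subset_span
        ⟨i, j, (X_mul_X_eq_monomial _ _).symm⟩)) hle)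
    obtain ⟨k, hk⟩ := exists_degree_ne_zero_of_mem_blockIdeal (by decide) (Ideal.mul_le_left hf) h0
    have hk1 : MonomialOrder.lex.degree f (toLex (0, k)) = 1 := by
      have := hxx k k
      rw [← Finsupp.single_add, Finsupp.single_le_iff] at this
      omega
    have hx : ∀ i ≠ k, MonomialOrder.lex.degree f (toLex (0, i)) = 0 := by
      intro i hi
      by_contra h
      exact hxx i k (single_add_single_le (by simpa using hi) h hk)
    obtain ⟨l, hkl, hl⟩ := exists_lt_degree_ne_zero hf h0 hk1 hx
    exact hmem (monomial_mem_of_le (Ideal.mem_sup_right (Ideal.subset_span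
      ⟨k, l, hkl, (X_mul_X_eq_monomial _ _).symm⟩)) (single_add_single_le (by simp) hk hl))
  · refine sup_le (Ideal.span_le.2 ?_) (Ideal.span_le.2 ?_)
    · rintro _ ⟨i, j, rfl⟩
      have hi := block_lt (show (0 : Fin 3) < 2 by decide) i i
      have hj := block_lt (show (0 : Fin 3) < 1 by decide) j j
      rw [xv, xv, X_mul_X_eq_monomial]
      exact monomial_mem_initialIdeal
        (Ideal.mul_mem_mul (X_sub_X_mem_blockIdeal 0 2 i) (X_sub_X_mem_blockIdeal 0 1 j))
        (mul_ne_zero (X_sub_X_ne_zero hi) (X_sub_X_ne_zero hj)) (degree_X_sub_X_mul hi hj)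
    · rintro _ ⟨k, l, hkl, rfl⟩
      exact X_mul_X_mem_initialIdeal hkl
end

section
/- Let ε = (1,1,…,1) be the all-ones signature, so I^x = ⟨y_i − z_i⟩, I^y = ⟨z_i − x_i⟩, I^z = ⟨x_i − y_i⟩. Then the initial ideal of the triple intersection with respect to ≺_N is in(I^x ∩ I^y ∩ I^z) = ⟨x_i x_j y_k : 1 ≤ i,j,k ≤ N⟩ + ⟨x_ℓ y_m : 1 ≤ ℓ < m ≤ N⟩; in particular the set {T^{ijk} = (x_i − y_i)(y_j − z_j)(z_k − x_k) : 1 ≤ i,j,k ≤ N} ∪ {P^{ij} = (z_i − x_i)(x_j − y_j) − (z_j − x_j)(x_i − y_i) : 1 ≤ i,j ≤ N}, whose leading monomials are x_i x_k y_j and (for i < j) x_i y_j, is a Gröbner basis of I^x ∩ I^y ∩ I^z with respect to ≺_N. -/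
open MvPolynomial

/-- The polynomial `T^{ijk} = (x_i - y_i)(y_j - z_j)(z_k - x_k)` (all-ones
signature). -/
noncomputable def Tpoly {N : ℕ} (i j k : Fin N) :
    MvPolynomial (Lex (Fin 3 × Fin N)) ℝ :=
  (xv i - yv i) * (yv j - zv j) * (zv k - xv k)

/-- The polynomial `P^{ij} = (z_i - x_i)(x_j - y_j) - (z_j - x_j)(x_i - y_i)`. -/
noncomputable def Ppoly {N : ℕ} (i j : Fin N) :
    MvPolynomial (Lex (Fin 3 × Fin N)) ℝ :=
  (zv i - xv i) * (xv j - yv j) - (zv j - xv j) * (xv i - yv i)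

open scoped MonomialOrder

/-- If every leading monomial of `B ⊆ I` detects `I` in the sense that the only element of `I`
none of whose monomials is divisible by a leading monomial of `B` is zero, then `B` generates `I`
and the leading monomials of `B` generate the initial ideal of `I`. -/
theorem span_eq_and_initialIdeal_eq_of_standard_eq_zero {σ : Type*} (m : MonomialOrder σ)
    {I : Ideal (MvPolynomial σ ℝ)} {B : Set (MvPolynomial σ ℝ)} (hBI : B ⊆ I)
    (hB : ∀ b ∈ B, b ≠ 0)
    (hstd : ∀ r ∈ I, (∀ c ∈ r.support, ∀ b ∈ B, ¬ m.degree b ≤ c) → r = 0) :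
    Ideal.span B = I ∧
      initialIdeal m I = Ideal.span ((fun b => monomial (m.degree b) (1 : ℝ)) '' B) := by
  have hdiv : ∀ f ∈ I, ∃ g : B →₀ MvPolynomial σ ℝ,
      f = Finsupp.linearCombination _ (fun b : B => (b : MvPolynomial σ ℝ)) g ∧
        ∀ b : B, m.degree ((b : MvPolynomial σ ℝ) * g b) ≼[m] m.degree f := by
    intro f hf
    obtain ⟨g, r, hfr, hdeg, hr⟩ := m.div_set
      (fun b hb => isUnit_iff_ne_zero.2 (m.leadingCoeff_ne_zero_iff.2 (hB b hb))) f
    have hmem : Finsupp.linearCombination _ (fun b : B => (b : MvPolynomial σ ℝ)) g ∈ I := by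
      rw [Finsupp.linearCombination_apply]
      exact I.sum_mem fun b _ => I.mul_mem_left _ (hBI b.2)
    have hrI : r ∈ I := by
      have := I.sub_mem hf hmem
      rwa [hfr, add_sub_cancel_left] at this
    refine ⟨g, ?_, hdeg⟩
    rw [hfr, hstd r hrI hr, add_zero]
  refine ⟨le_antisymm (Ideal.span_le.2 hBI) fun f hf => ?_, le_antisymm ?_ ?_⟩
  · obtain ⟨g, rfl, -⟩ := hdiv f hf
    rw [Finsupp.linearCombination_apply]
    exact Ideal.sum_mem _ fun b _ => Ideal.mul_mem_left _ _ (Ideal.subset_span b.2)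
  · refine Ideal.span_le.2 ?_
    rintro _ ⟨f, hf, hf0, rfl⟩
    obtain ⟨g, hfg, hdeg⟩ := hdiv f hf
    have hc : f.coeff (m.degree f) ≠ 0 := m.coeff_degree_ne_zero_iff.2 hf0
    rw [show f.coeff (m.degree f) = coeff (m.degree f) (Finsupp.linearCombination _ _ g) from
      congrArg _ hfg] at hc
    rw [Finsupp.linearCombination_apply, Finsupp.sum, coeff_sum] at hc
    obtain ⟨b, -, hb⟩ := Finset.exists_ne_zero_of_sum_ne_zero hc
    rw [smul_eq_mul, mul_comm] at hb
    have hbg : (b : MvPolynomial σ ℝ) * g b ≠ 0 := by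
      intro h
      simp [h] at hb
    have heq : m.degree f = m.degree ((b : MvPolynomial σ ℝ) * g b) :=
      m.toSyn.injective (le_antisymm (m.le_degree (mem_support_iff.2 hb)) (hdeg b))
    have hmul : monomial (mDegree m f) (1 : ℝ) =
        monomial (m.degree (g b)) 1 * monomial (m.degree (b : MvPolynomial σ ℝ)) 1 := by
      rw [monomial_mul, one_mul, add_comm, ← m.degree_mul' hbg, ← heq]
      rfl
    rw [hmul]
    exact Ideal.mul_mem_left _ _ (Ideal.subset_span ⟨b, b.2, rfl⟩)
  · refine Ideal.span_mono ?_
    rintro _ ⟨b, hb, rfl⟩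
    exact ⟨b, hBI hb, hB b hb, rfl⟩

/-- In the lexicographic order, a polynomial involving only variables smaller than `v` has degree
smaller than any exponent involving `v`. -/
theorem degree_lex_lt_of_mem_supported {σ : Type*} [LinearOrder σ] [WellFoundedGT σ]
    {q : MvPolynomial σ ℝ} {v : σ} (hq : q ∈ supported ℝ (Set.Ioi v)) {e : σ →₀ ℕ}
    (he : e v ≠ 0) : MonomialOrder.lex.degree q ≺[MonomialOrder.lex] e := by
  have hz : ∀ s ≤ v, MonomialOrder.lex.degree q s = 0 := by
    intro s hs
    by_contra h
    have hq0 : q ≠ 0 := by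
      rintro rfl
      simp at h
    have hmem : s ∈ q.vars :=
      (mem_vars_iff_mem_support _).2 ⟨_, MonomialOrder.lex.degree_mem_support hq0, Finsupp.mem_support_iff.2 h⟩
    exact absurd (mem_supported.1 hq hmem) (not_lt.2 hs)
  refine lt_of_lt_of_le (b := MonomialOrder.lex.toSyn (Finsupp.single v 1)) ?_
    (MonomialOrder.lex.toSyn_monotone (by simpa using Nat.one_le_iff_ne_zero.2 he))
  rw [MonomialOrder.lex_lt_iff, Finsupp.Lex.lt_iff]
  refine ⟨v, fun j hj => ?_, ?_⟩
  · simp [hz j hj.le, hj.ne]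
  · simp [hz v le_rfl]

theorem degree_lex_X_sub_X {σ : Type*} [LinearOrder σ] [WellFoundedGT σ] {v w : σ} (h : v < w) :
    MonomialOrder.lex.degree (X v - X w : MvPolynomial σ ℝ) = Finsupp.single v 1 := by
  rw [MonomialOrder.degree_sub_of_lt, MonomialOrder.degree_X]
  rw [MonomialOrder.degree_X (s := v)]
  exact degree_lex_lt_of_mem_supported (X_mem_supported.2 h) (by simp)

section

variable {N : ℕ}

theorem toLex_zero_lt_toLex {a : Fin 3} (ha : 0 < a) (i j : Fin N) :
    toLex ((0 : Fin 3), i) < toLex (a, j) :=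
  Prod.Lex.toLex_lt_toLex.2 (Or.inl ha)

theorem toLex_one_lt_toLex_two (i j : Fin N) :
    toLex ((1 : Fin 3), i) < toLex ((2 : Fin 3), j) :=
  Prod.Lex.toLex_lt_toLex.2 (Or.inl (Fin.lt_def.2 one_lt_two))

theorem X_sub_X_ne_zero_s13 {σ : Type*} {v w : σ} (h : v ≠ w) :
    (X v - X w : MvPolynomial σ ℝ) ≠ 0 :=
  sub_ne_zero.2 fun h' => h (X_injective h')

theorem Tpoly_ne_zero (i j k : Fin N) : Tpoly i j k ≠ 0 :=
  mul_ne_zero (mul_ne_zero (X_sub_X_ne_zero_s13 (by simp)) (X_sub_X_ne_zero_s13 (by simp)))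
    (X_sub_X_ne_zero_s13 (by simp))

theorem degree_Tpoly (i j k : Fin N) :
    MonomialOrder.lex.degree (Tpoly i j k) = Finsupp.single (toLex ((0 : Fin 3), i)) 1 +
      Finsupp.single (toLex ((1 : Fin 3), j)) 1 + Finsupp.single (toLex ((0 : Fin 3), k)) 1 := by
  have h := Tpoly_ne_zero i j k
  have h' := left_ne_zero_of_mul h
  rw [Tpoly, MonomialOrder.degree_mul' h, MonomialOrder.degree_mul' h',
    ← neg_sub (xv k) (zv k), MonomialOrder.degree_neg, xv, yv, yv, zv, xv, zv,
    degree_lex_X_sub_X (toLex_zero_lt_toLex (by decide) _ _),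
    degree_lex_X_sub_X (toLex_one_lt_toLex_two _ _),
    degree_lex_X_sub_X (toLex_zero_lt_toLex (by decide) _ _)]

theorem degree_Ppoly {i j : Fin N} (hij : i < j) :
    MonomialOrder.lex.degree (Ppoly i j) = Finsupp.single (toLex ((0 : Fin 3), i)) 1 +
      Finsupp.single (toLex ((1 : Fin 3), j)) 1 := by
  have hP : Ppoly i j = xv i * (yv j - zv j) +
      (xv j * (zv i - yv i) + (zv j * yv i - zv i * yv j)) := by
    rw [Ppoly]
    ring
  have hlead : MonomialOrder.lex.degree (xv i * (yv j - zv j)) =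
      Finsupp.single (toLex ((0 : Fin 3), i)) 1 + Finsupp.single (toLex ((1 : Fin 3), j)) 1 := by
    rw [xv, yv, zv, MonomialOrder.degree_mul (X_ne_zero _) (X_sub_X_ne_zero_s13 (by simp)),
      degree_lex_X_sub_X (toLex_one_lt_toLex_two _ _), MonomialOrder.degree_X]
  rw [hP, MonomialOrder.degree_add_of_lt, hlead]
  rw [hlead]
  refine degree_lex_lt_of_mem_supported (v := toLex ((0 : Fin 3), i)) ?_ (by simp)
  have hx : xv j ∈ supported ℝ (Set.Ioi (toLex ((0 : Fin 3), i))) :=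
    X_mem_supported.2 (Prod.Lex.toLex_lt_toLex.2 (Or.inr ⟨rfl, hij⟩))
  have hy : ∀ k, yv k ∈ supported ℝ (Set.Ioi (toLex ((0 : Fin 3), i))) := fun k =>
    X_mem_supported.2 (toLex_zero_lt_toLex (by decide) _ _)
  have hz : ∀ k, zv k ∈ supported ℝ (Set.Ioi (toLex ((0 : Fin 3), i))) := fun k =>
    X_mem_supported.2 (toLex_zero_lt_toLex (by decide) _ _)
  exact add_mem (mul_mem hx (sub_mem (hz _) (hy _)))
    (sub_mem (mul_mem (hz _) (hy _)) (mul_mem (hz _) (hy _)))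

theorem Ppoly_ne_zero {i j : Fin N} (hij : i < j) : Ppoly i j ≠ 0 :=
  MonomialOrder.lex.ne_zero_of_degree_ne_zero (by
    rw [degree_Ppoly hij]
    intro h
    simpa using DFunLike.congr_fun h (toLex ((0 : Fin 3), i)))

/-- The point of the `3N`-dimensional space with coordinate blocks `x`, `y` and `z`. -/
def blockPoint (x y z : Fin N → ℝ) : Lex (Fin 3 × Fin N) → ℝ :=
  fun s => ![x, y, z] (ofLex s).1 (ofLex s).2

@[simp]
theorem blockPoint_zero (x y z : Fin N → ℝ) (i : Fin N) :
    blockPoint x y z (toLex ((0 : Fin 3), i)) = x i := rfl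

@[simp]
theorem blockPoint_one (x y z : Fin N → ℝ) (i : Fin N) :
    blockPoint x y z (toLex ((1 : Fin 3), i)) = y i := rfl

@[simp]
theorem blockPoint_two (x y z : Fin N → ℝ) (i : Fin N) :
    blockPoint x y z (toLex ((2 : Fin 3), i)) = z i := rfl

@[simp]
theorem eval_xv (x y z : Fin N → ℝ) (i : Fin N) : eval (blockPoint x y z) (xv i) = x i := by
  simp [xv]

@[simp]
theorem eval_yv (x y z : Fin N → ℝ) (i : Fin N) : eval (blockPoint x y z) (yv i) = y i := by
  simp [yv]

@[simp]
theorem eval_zv (x y z : Fin N → ℝ) (i : Fin N) : eval (blockPoint x y z) (zv i) = z i := by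
  simp [zv]

theorem forall_lex_fin_three {p : Lex (Fin 3 × Fin N) → Prop}
    (h0 : ∀ i, p (toLex ((0 : Fin 3), i))) (h1 : ∀ i, p (toLex ((1 : Fin 3), i)))
    (h2 : ∀ i, p (toLex ((2 : Fin 3), i))) (s : Lex (Fin 3 × Fin N)) : p s := by
  induction s using Lex.rec with
  | h s =>
    obtain ⟨a, i⟩ := s
    fin_cases a
    exacts [h0 i, h1 i, h2 i]

theorem eq_zero_of_eval_blockPoint {f : MvPolynomial (Lex (Fin 3 × Fin N)) ℝ}
    (h : ∀ x y z, eval (blockPoint x y z) f = 0) : f = 0 := by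
  refine MvPolynomial.funext fun v => ?_
  have hv : v = blockPoint (fun i => v (toLex (0, i))) (fun i => v (toLex (1, i)))
      (fun i => v (toLex (2, i))) :=
    _root_.funext (forall_lex_fin_three (fun _ => rfl) (fun _ => rfl) fun _ => rfl)
  rw [hv, h, map_zero]

theorem eval_monomial_congr {σ : Type*} {s : σ →₀ ℕ} (c : ℝ) {v w : σ → ℝ}
    (h : ∀ i, s i ≠ 0 → v i = w i) : eval v (monomial s c) = eval w (monomial s c) := by
  rw [eval_monomial, eval_monomial]
  congr 1
  exact Finset.prod_congr rfl fun i hi =>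
    congrArg (· ^ s i) (h i (Finsupp.mem_support_iff.1 hi))

theorem eval_monomial_eq_zero {σ : Type*} {s : σ →₀ ℕ} (c : ℝ) {v : σ → ℝ} {i : σ}
    (hs : s i ≠ 0) (hv : v i = 0) : eval v (monomial s c) = 0 := by
  rw [eval_monomial, Finsupp.prod,
    Finset.prod_eq_zero (Finsupp.mem_support_iff.2 hs) (by rw [hv, zero_pow hs]), mul_zero]

/-- The shape `f = A(y, z) + B(x, z) + ∑ x_l C_l(y_1, …, y_l, z)`, with `B(0, z) = 0` and
`C_l(0, z) = 0`, of the real combinations of monomials divisible neither by any `x_i x_j y_k`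
nor by any `x_l y_m` with `l < m`. -/
def IsStandardForm (f : MvPolynomial (Lex (Fin 3 × Fin N)) ℝ) : Prop :=
  ∃ (A B : (Fin N → ℝ) → (Fin N → ℝ) → ℝ) (C : Fin N → MvPolynomial (Lex (Fin 3 × Fin N)) ℝ),
    (∀ z, B 0 z = 0) ∧ (∀ l x z, eval (blockPoint x 0 z) (C l) = 0) ∧
    (∀ l x x' y y' z, (∀ k ≤ l, y k = y' k) →
      eval (blockPoint x y z) (C l) = eval (blockPoint x' y' z) (C l)) ∧
    ∀ x y z, eval (blockPoint x y z) f =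
      A y z + B x z + ∑ l, x l * eval (blockPoint x y z) (C l)

theorem IsStandardForm.zero : IsStandardForm (0 : MvPolynomial (Lex (Fin 3 × Fin N)) ℝ) :=
  ⟨0, 0, 0, by simp, by simp, by simp, by simp⟩

theorem IsStandardForm.add {f g : MvPolynomial (Lex (Fin 3 × Fin N)) ℝ}
    (hf : IsStandardForm f) (hg : IsStandardForm g) : IsStandardForm (f + g) := by
  obtain ⟨A, B, C, hB, hC0, hC, hf⟩ := hf
  obtain ⟨A', B', C', hB', hC0', hC', hg⟩ := hg
  refine ⟨A + A', B + B', C + C', by simp [hB, hB'], by simp [hC0, hC0'], ?_, ?_⟩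
  · intro l x x' y y' z h
    simp [hC l x x' y y' z h, hC' l x x' y y' z h]
  · intro x y z
    simp only [map_add, hf, hg, Pi.add_apply, mul_add, Finset.sum_add_distrib]
    ring

theorem isStandardForm_monomial {s : Lex (Fin 3 × Fin N) →₀ ℕ} (c : ℝ)
    (hT : ∀ i j k : Fin N, ¬ (Finsupp.single (toLex ((0 : Fin 3), i)) 1 +
      Finsupp.single (toLex ((1 : Fin 3), j)) 1 + Finsupp.single (toLex ((0 : Fin 3), k)) 1 ≤ s))
    (hP : ∀ i j : Fin N, i < j → ¬ (Finsupp.single (toLex ((0 : Fin 3), i)) 1 +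
      Finsupp.single (toLex ((1 : Fin 3), j)) 1 ≤ s)) :
    IsStandardForm (monomial s c) := by
  by_cases hx : ∀ i, s (toLex ((0 : Fin 3), i)) = 0
  · refine ⟨fun y z => eval (blockPoint 0 y z) (monomial s c), 0, 0, by simp, by simp, by simp,
      fun x y z => ?_⟩
    simp only [Pi.zero_apply, map_zero, mul_zero, Finset.sum_const_zero, add_zero]
    exact eval_monomial_congr c (forall_lex_fin_three (fun i hi => absurd (hx i) hi)
      (fun _ _ => rfl) fun _ _ => rfl)
  push Not at hx
  obtain ⟨l, hl⟩ := hx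
  by_cases hy : ∀ i, s (toLex ((1 : Fin 3), i)) = 0
  · refine ⟨0, fun x z => eval (blockPoint x 0 z) (monomial s c), 0,
      fun z => eval_monomial_eq_zero c hl rfl, by simp, by simp, fun x y z => ?_⟩
    simp only [Pi.zero_apply, map_zero, mul_zero, Finset.sum_const_zero, add_zero, zero_add]
    exact eval_monomial_congr c (forall_lex_fin_three (fun _ _ => rfl)
      (fun i hi => absurd (hy i) hi) fun _ _ => rfl)
  push Not at hy
  obtain ⟨j, hj⟩ := hy
  set t := s - Finsupp.single (toLex ((0 : Fin 3), l)) 1 with ht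
  have hst : Finsupp.single (toLex ((0 : Fin 3), l)) 1 + t = s :=
    add_tsub_cancel_of_le (by simpa using Nat.one_le_iff_ne_zero.2 hl)
  have htx : ∀ k, t (toLex ((0 : Fin 3), k)) = 0 := by
    intro k
    by_contra hk
    refine hT l j k ?_
    rw [← hst, add_assoc]
    refine add_le_add_right (forall_lex_fin_three (fun i => ?_) (fun i => ?_) fun i => ?_) _
    · by_cases h : k = i
      · subst h
        simpa using Nat.one_le_iff_ne_zero.2 hk
      · simp [h]
    · by_cases h : j = i
      · subst h
        simpa [ht] using Nat.one_le_iff_ne_zero.2 hj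
      · simp [h]
    · simp
  have hty : ∀ k, l < k → t (toLex ((1 : Fin 3), k)) = 0 := by
    intro k hlk
    by_contra hk
    refine hP l k hlk ?_
    rw [← hst]
    exact add_le_add_right (by simpa using Nat.one_le_iff_ne_zero.2 hk) _
  have htj : t (toLex ((1 : Fin 3), j)) ≠ 0 := by simpa [ht] using hj
  refine ⟨0, 0, Pi.single l (monomial t c), by simp, fun k x z => ?_,
    fun k x x' y y' z h => ?_, fun x y z => ?_⟩
  · by_cases hkl : k = l
    · subst hkl
      rw [Pi.single_eq_same]
      exact eval_monomial_eq_zero c htj rfl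
    · simp [hkl]
  · by_cases hkl : k = l
    · subst hkl
      rw [Pi.single_eq_same]
      refine eval_monomial_congr c (forall_lex_fin_three (fun i hi => absurd (htx i) hi)
        (fun i hi => h i (not_lt.1 fun hki => hi (hty i hki))) fun _ _ => rfl)
    · simp [hkl]
  · rw [Finset.sum_eq_single l (fun k _ hk => by simp [hk]) (by simp), Pi.single_eq_same, ← hst]
    rw [← one_mul c, ← monomial_mul, map_mul, one_mul, ← X, eval_X, blockPoint_zero]
    simp

/-- A polynomial in standard form that vanishes on the three subspaces `y = z`, `z = x` and
`x = y` is zero. -/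
theorem IsStandardForm.eq_zero {f : MvPolynomial (Lex (Fin 3 × Fin N)) ℝ}
    (hf : IsStandardForm f) (hx : ∀ x z, eval (blockPoint x z z) f = 0)
    (hy : ∀ x y, eval (blockPoint x y x) f = 0) (hz : ∀ x z, eval (blockPoint x x z) f = 0) :
    f = 0 := by
  obtain ⟨A, B, C, hB, hC0, hC, hf⟩ := hf
  let φ : Lex (Fin 3 × Fin N) → Lex (Fin 3 × Fin N) := fun s =>
    toLex (if (ofLex s).1 = 1 then 2 else (ofLex s).1, (ofLex s).2)
  have hφ : ∀ x y z, blockPoint x y z ∘ φ = blockPoint x z z := fun x y z =>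
    _root_.funext (forall_lex_fin_three (fun _ => rfl) (fun _ => rfl) fun _ => rfl)
  let c : Fin N → (Fin N → ℝ) → (Fin N → ℝ) → ℝ := fun l y z => eval (blockPoint 0 y z) (C l)
  have hc : ∀ l x y z, eval (blockPoint x y z) (C l) = c l y z := fun l x y z =>
    hC l x 0 y y z fun _ _ => rfl
  simp only [hc] at hf
  have hA : ∀ z, A z z = 0 := fun z => by
    have := hx 0 z
    rw [hf, hB] at this
    simpa using this
  have hBz : ∀ x z, B x z = -∑ l, x l * c l z z := fun x z => by
    have := hx x z
    rw [hf, hA] at this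
    linarith
  have hsum : ∀ y z, ∑ l, (y l - z l) * (c l y z - c l z z) = 0 := fun y z => by
    have h1 := hz y z
    have h2 := hy z y
    rw [hf, hBz] at h1 h2
    simp only [sub_mul, mul_sub, Finset.sum_sub_distrib]
    linarith
  have hE : ∀ l y z, c l y z = c l z z := by
    intro l
    induction l using WellFoundedLT.induction with
    | ind l ih =>
    have hprod : (yv l - zv l) * (C l - rename φ (C l)) = 0 := by
      refine eq_zero_of_eval_blockPoint fun x y z => ?_
      rw [map_mul, map_sub, map_sub, eval_rename, hφ, eval_yv, eval_zv, hc, hc]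
      have hy' : c l y z = c l (fun k => if k ≤ l then y k else z k) z :=
        hC l 0 0 _ _ z fun k hk => by simp [hk]
      have := hsum (fun k => if k ≤ l then y k else z k) z
      rw [Finset.sum_eq_single l _ (by simp)] at this
      · simpa [← hy'] using this
      · intro k _ hk
        rcases lt_or_gt_of_ne hk with hk | hk
        · rw [ih k hk, sub_self, mul_zero]
        · simp [not_le.2 hk]
    have h0 := (mul_eq_zero.1 hprod).resolve_left (X_sub_X_ne_zero_s13 (by simp))
    intro y z
    have := congrArg (eval (blockPoint 0 y z)) h0
    rw [map_sub, eval_rename, hφ, hc, hc, map_zero] at this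
    linarith
  have hc0 : ∀ l y z, c l y z = 0 := fun l y z => by
    rw [hE, ← hE l 0 z]
    exact hC0 l 0 z
  have hB0 : ∀ x z, B x z = 0 := fun x z => by simp [hBz, hc0]
  refine eq_zero_of_eval_blockPoint fun x y z => ?_
  have := hz y z
  rw [hf] at this ⊢
  simpa [hc0, hB0] using this

theorem eval_eq_zero_of_mem_span {σ : Type*} {S : Set (MvPolynomial σ ℝ)} {v : σ → ℝ}
    (hS : ∀ q ∈ S, eval v q = 0) {f : MvPolynomial σ ℝ} (hf : f ∈ Ideal.span S) :
    eval v f = 0 :=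
  RingHom.mem_ker.1 ((Ideal.span_le (I := RingHom.ker (eval v))).2 hS hf)

theorem Tpoly_mem (i j k : Fin N) :
    Tpoly i j k ∈ Ideal.span {q | ∃ i : Fin N, q = yv i - zv i} ⊓
      Ideal.span {q | ∃ i : Fin N, q = zv i - xv i} ⊓
      Ideal.span {q | ∃ i : Fin N, q = xv i - yv i} :=
  ⟨⟨Ideal.mul_mem_right _ _ (Ideal.mul_mem_left _ _ (Ideal.subset_span ⟨j, rfl⟩)),
    Ideal.mul_mem_left _ _ (Ideal.subset_span ⟨k, rfl⟩)⟩,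
    Ideal.mul_mem_right _ _ (Ideal.mul_mem_right _ _ (Ideal.subset_span ⟨i, rfl⟩))⟩

theorem Ppoly_mem (i j : Fin N) :
    Ppoly i j ∈ Ideal.span {q | ∃ i : Fin N, q = yv i - zv i} ⊓
      Ideal.span {q | ∃ i : Fin N, q = zv i - xv i} ⊓
      Ideal.span {q | ∃ i : Fin N, q = xv i - yv i} := by
  refine ⟨⟨?_, ?_⟩, ?_⟩
  · have h : Ppoly i j = (zv j - xv j) * (yv i - zv i) - (zv i - xv i) * (yv j - zv j) := by
      rw [Ppoly]
      ring
    rw [h]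
    exact sub_mem (Ideal.mul_mem_left _ _ (Ideal.subset_span ⟨i, rfl⟩))
      (Ideal.mul_mem_left _ _ (Ideal.subset_span ⟨j, rfl⟩))
  · exact sub_mem (Ideal.mul_mem_right _ _ (Ideal.subset_span ⟨i, rfl⟩))
      (Ideal.mul_mem_right _ _ (Ideal.subset_span ⟨j, rfl⟩))
  · exact sub_mem (Ideal.mul_mem_left _ _ (Ideal.subset_span ⟨j, rfl⟩))
      (Ideal.mul_mem_left _ _ (Ideal.subset_span ⟨i, rfl⟩))

theorem monomial_degree_Tpoly (i j k : Fin N) :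
    monomial (MonomialOrder.lex.degree (Tpoly i j k)) (1 : ℝ) = xv i * xv k * yv j := by
  rw [degree_Tpoly, xv, xv, yv, X, X, X, monomial_mul, monomial_mul, add_right_comm]
  simp

theorem monomial_degree_Ppoly {i j : Fin N} (hij : i < j) :
    monomial (MonomialOrder.lex.degree (Ppoly i j)) (1 : ℝ) = xv i * yv j := by
  rw [degree_Ppoly hij, xv, yv, X, X, monomial_mul, one_mul]

end

/-- For the all-ones signature, with `I^x = ⟨y_i - z_i⟩`,
`I^y = ⟨z_i - x_i⟩`, `I^z = ⟨x_i - y_i⟩` and the lexicographic monomial order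
`≺_N`: the initial ideal of the triple intersection is
`in(I^x ∩ I^y ∩ I^z) = ⟨x_i x_j y_k : all i,j,k⟩ + ⟨x_ℓ y_m : ℓ < m⟩`; the set
`{T^{ijk}} ∪ {P^{ij}}` generates `I^x ∩ I^y ∩ I^z`; and its leading monomials
are `x_i x_k y_j` (for `T^{ijk}`) and, for `i < j`, `x_i y_j` (for `P^{ij}`) —
so that `{T^{ijk}} ∪ {P^{ij}}` is a Gröbner basis of `I^x ∩ I^y ∩ I^z` with
respect to `≺_N`. -/
theorem stmt_13 (N : ℕ) (hN : 0 < N)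
    (Ix Iy Iz : Ideal (MvPolynomial (Lex (Fin 3 × Fin N)) ℝ))
    (hIx : Ix = Ideal.span {q | ∃ i : Fin N, q = yv i - zv i})
    (hIy : Iy = Ideal.span {q | ∃ i : Fin N, q = zv i - xv i})
    (hIz : Iz = Ideal.span {q | ∃ i : Fin N, q = xv i - yv i}) :
    initialIdeal MonomialOrder.lex (Ix ⊓ Iy ⊓ Iz) =
        Ideal.span {q | ∃ i j k : Fin N, q = xv i * xv j * yv k} ⊔
          Ideal.span {q | ∃ l m : Fin N, l < m ∧ q = xv l * yv m} ∧
    Ideal.span ({q | ∃ i j k : Fin N, q = Tpoly i j k} ∪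
        {q | ∃ i j : Fin N, q = Ppoly i j}) = Ix ⊓ Iy ⊓ Iz ∧
    (∀ i j k : Fin N,
        (monomial (mDegree MonomialOrder.lex (Tpoly i j k)) (1 : ℝ)) =
          xv i * xv k * yv j) ∧
    (∀ i j : Fin N, i < j →
        (monomial (mDegree MonomialOrder.lex (Ppoly i j)) (1 : ℝ)) = xv i * yv j) := by
  have hmem : ({q | ∃ i j k : Fin N, q = Tpoly i j k} ∪ {q | ∃ i j : Fin N, q = Ppoly i j}) ⊆
      ((Ix ⊓ Iy ⊓ Iz : Ideal _) : Set (MvPolynomial (Lex (Fin 3 × Fin N)) ℝ)) := by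
    subst hIx hIy hIz
    rintro _ (⟨i, j, k, rfl⟩ | ⟨i, j, rfl⟩)
    exacts [Tpoly_mem i j k, Ppoly_mem i j]
  have hsub : ({q | ∃ i j k : Fin N, q = Tpoly i j k} ∪
      {q | ∃ i j : Fin N, i < j ∧ q = Ppoly i j}) ⊆
      ({q | ∃ i j k : Fin N, q = Tpoly i j k} ∪ {q | ∃ i j : Fin N, q = Ppoly i j}) :=
    Set.union_subset_union_right _ fun _ ⟨i, j, _, hq⟩ => ⟨i, j, hq⟩
  obtain ⟨hspan, hinit⟩ : Ideal.span _ = _ ∧ _ := by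
    refine span_eq_and_initialIdeal_eq_of_standard_eq_zero MonomialOrder.lex
      (hsub.trans hmem) ?_ ?_
    · rintro _ (⟨i, j, k, rfl⟩ | ⟨i, j, hij, rfl⟩)
      exacts [Tpoly_ne_zero i j k, Ppoly_ne_zero hij]
    · subst hIx hIy hIz
      rintro r ⟨⟨hrx, hry⟩, hrz⟩ hr
      have hstd : IsStandardForm r := by
        rw [← support_sum_monomial_coeff r]
        refine Finset.sum_induction _ IsStandardForm (fun _ _ => IsStandardForm.add)
          IsStandardForm.zero fun s hs => isStandardForm_monomial _ (fun i j k => ?_)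
            fun i j hij => ?_
        · rw [← degree_Tpoly]
          exact hr s hs _ (Or.inl ⟨i, j, k, rfl⟩)
        · rw [← degree_Ppoly hij]
          exact hr s hs _ (Or.inr ⟨i, j, hij, rfl⟩)
      refine hstd.eq_zero (fun x z => eval_eq_zero_of_mem_span ?_ hrx)
        (fun x y => eval_eq_zero_of_mem_span ?_ hry) fun x z => eval_eq_zero_of_mem_span ?_ hrz
      all_goals
        rintro _ ⟨i, rfl⟩
        simp
  refine ⟨?_, le_antisymm (Ideal.span_le.2 hmem) (hspan.ge.trans (Ideal.span_mono hsub)),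
    monomial_degree_Tpoly, fun i j => monomial_degree_Ppoly⟩
  rw [hinit, Set.image_union, Ideal.span_union]
  congr 2 <;> ext q
  · constructor
    · rintro ⟨_, ⟨i, j, k, rfl⟩, rfl⟩
      exact ⟨i, k, j, monomial_degree_Tpoly i j k⟩
    · rintro ⟨i, k, j, rfl⟩
      exact ⟨_, ⟨i, j, k, rfl⟩, monomial_degree_Tpoly i j k⟩
  · constructor
    · rintro ⟨_, ⟨i, j, hij, rfl⟩, rfl⟩
      exact ⟨i, j, hij, monomial_degree_Ppoly hij⟩
    · rintro ⟨i, j, hij, rfl⟩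
      exact ⟨_, ⟨i, j, hij, rfl⟩, monomial_degree_Ppoly hij⟩
end
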